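/- Let $0 < \theta_\epsilon < \pi/4$ and let $m_{\max}$ be the smallest natural number such that $(2m_{\max}+1)\theta_\epsilon \geq \pi/4$. If $\theta \in [\theta_\epsilon, \pi/2]$, then there exists a natural number $m \leq m_{\max}$ with $\sin^2((2m+1)\theta) \geq 1/2$. -/

import Mathlib

open Real

lemma half_le_sin_sq {x : ℝ} (h₁ : π / 4 ≤ x) (h₂ : x ≤ 3 * π / 4) :
    1 / 2 ≤ Real.sin x ^ 2 := by
  have hcos : Real.cos (2 * x) ≤ 0 :=
    Real.cos_nonpos_of_pi_div_two_le_of_le (by linarith) (by linarith)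
  rw [Real.sin_sq_eq_half_sub]
  linarith

theorem stmt_1 (θε : ℝ) (hθε0 : 0 < θε) (hθε1 : θε < π / 4)
    (mmax : ℕ) (hmmax : IsLeast {m : ℕ | π / 4 ≤ (2 * (m : ℝ) + 1) * θε} mmax)
    (θ : ℝ) (hθ0 : θε ≤ θ) (hθ1 : θ ≤ π / 2) :
    ∃ m : ℕ, m ≤ mmax ∧ 1 / 2 ≤ Real.sin ((2 * (m : ℝ) + 1) * θ) ^ 2 := by
  classical
  have hmax : π / 4 ≤ (2 * (mmax : ℝ) + 1) * θ :=
    le_trans hmmax.1 (by gcongr)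
  have hex : ∃ m : ℕ, π / 4 ≤ (2 * (m : ℝ) + 1) * θ := ⟨mmax, hmax⟩
  obtain ⟨m, hm, hmin⟩ : ∃ m : ℕ, π / 4 ≤ (2 * (m : ℝ) + 1) * θ ∧
      ∀ k : ℕ, π / 4 ≤ (2 * (k : ℝ) + 1) * θ → m ≤ k :=
    ⟨Nat.find hex, Nat.find_spec hex, fun _ hk => Nat.find_min' hex hk⟩
  refine ⟨m, hmin mmax hmax, half_le_sin_sq hm ?_⟩
  cases m with
  | zero =>
    push_cast
    linarith [Real.pi_pos]
  | succ k =>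
    have hk : (2 * (k : ℝ) + 1) * θ < π / 4 := by
      by_contra! h
      have := hmin k h
      omega
    have h0 : θ ≤ π / 4 := by
      have : 0 ≤ (k : ℝ) * θ := mul_nonneg k.cast_nonneg (hθε0.le.trans hθ0)
      linarith
    push_cast
    linarith
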